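/- arXiv:1907.01711 — 2 statements merged into one kernel-verified Lean document; each statement's English description precedes it below -/
import Mathlib

section
/- Let d ≥ 1, let ε > 0, ρ̄ > 0, ā > 0 be constants and ū ∈ ℝ^d a constant vector. Let ρ : [0,∞) × ℝ^d → ℝ and u : [0,∞) × ℝ^d → ℝ^d be smooth functions, ℤ^d-periodic in the space variable, solving pointwise the linear wave equation system with advection: ∂_t ρ + ū·∇ρ + ρ̄ (∇·u) = 0 and ∂_t u + (ū·∇)u + (ā²/(ρ̄ ε²)) ∇ρ = 0. If at time t = 0 the data are well-prepared, i.e. ρ(0,·) is spatially constant and ∇·u(0,·) ≡ 0, then for every t ≥ 0 the solution remains well-prepared: ρ(t,·) is spatially constant and ∇·u(t,·) ≡ 0. -/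
/-- Partial derivative `∂f/∂xᵢ` of a scalar function on `ℝ^d`. -/
noncomputable def pd {d : ℕ} (i : Fin d) (f : (Fin d → ℝ) → ℝ) (x : Fin d → ℝ) : ℝ :=
  fderiv ℝ f x (Pi.single i 1)

/-- Constant-coefficient advection operator `(w·∇)f = Σᵢ wᵢ ∂f/∂xᵢ`. -/
noncomputable def adv {d : ℕ} (w : Fin d → ℝ) (f : (Fin d → ℝ) → ℝ) : (Fin d → ℝ) → ℝ :=
  fun x => ∑ i, w i * pd i f x

/-- Divergence `∇·u = Σᵢ ∂uᵢ/∂xᵢ` of a vector field on `ℝ^d`. -/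
noncomputable def dvg {d : ℕ} (u : (Fin d → ℝ) → Fin d → ℝ) : (Fin d → ℝ) → ℝ :=
  fun x => ∑ i, pd i (fun y => u y i) x

open MeasureTheory in
/-- Energy conservation through the space-time divergence theorem. -/
theorem energy_zero {d : ℕ} (κ β : ℝ) (hκ : 0 < κ) (hβ : 0 < β)
    (r : (Fin (d + 1) → ℝ) → ℝ) (w : Fin d → (Fin (d + 1) → ℝ) → ℝ)
    (hr : Differentiable ℝ r) (hw : ∀ j, Differentiable ℝ (w j))
    (hrp : ∀ p (i : Fin d), r (p + Pi.single i.succ 1) = r p)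
    (hwp : ∀ j p (i : Fin d), w j (p + Pi.single i.succ 1) = w j p)
    (hr0 : ∀ p, p 0 = 0 → r p = 0) (hw0 : ∀ j p, p 0 = 0 → w j p = 0)
    (h1 : ∀ p : Fin (d + 1) → ℝ, 0 ≤ p 0 → fderiv ℝ r p (Pi.single 0 1)
      = - β * ∑ i : Fin d, fderiv ℝ (w i) p (Pi.single i.succ 1))
    (h2 : ∀ p : Fin (d + 1) → ℝ, 0 ≤ p 0 → ∀ j, fderiv ℝ (w j) p (Pi.single 0 1)
      = - κ * fderiv ℝ r p (Pi.single j.succ 1))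
    (p : Fin (d + 1) → ℝ) (hp : 0 ≤ p 0) : r p = 0 ∧ ∀ j, w j p = 0 := by
  let e : (Fin (d + 1) → ℝ) → ℝ := fun p => κ * r p ^ 2 + β * ∑ j, w j p ^ 2
  let f : Fin (d + 1) → (Fin (d + 1) → ℝ) → ℝ :=
    Fin.cons e (fun i p => 2 * κ * β * (r p * w i p))
  let e' : (Fin (d + 1) → ℝ) → (Fin (d + 1) → ℝ) →L[ℝ] ℝ := fun p =>
    κ • ((2 * r p) • fderiv ℝ r p) + β • ∑ j, (2 * w j p) • fderiv ℝ (w j) p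
  let f' : Fin (d + 1) → (Fin (d + 1) → ℝ) → (Fin (d + 1) → ℝ) →L[ℝ] ℝ :=
    Fin.cons e' (fun i p => (2 * κ * β) • (r p • fderiv ℝ (w i) p + w i p • fderiv ℝ r p))
  have he : ∀ p, HasFDerivAt e (e' p) p := by
    intro p
    have hA := ((hr p).hasFDerivAt.pow 2).const_mul κ
    have hB := (HasFDerivAt.fun_sum (u := Finset.univ)
      (fun j _ => ((hw j p).hasFDerivAt.pow 2))).const_mul β
    have := hA.add hB
    refine this.congr_fderiv ?_
    simp [e']
  have hf : ∀ i p, HasFDerivAt (f i) (f' i p) p := by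
    intro i p
    refine Fin.cases ?_ (fun i => ?_) i
    · exact he p
    · exact (((hr p).hasFDerivAt.mul (hw i p).hasFDerivAt).const_mul (2 * κ * β))
  have hec : Continuous e := continuous_iff_continuousAt.2 fun p => (he p).continuousAt
  have hdiv : ∀ p : Fin (d + 1) → ℝ, 0 ≤ p 0 → ∑ i, f' i p (Pi.single i 1) = 0 := by
    intro p hp
    rw [Fin.sum_univ_succ]
    simp only [f', e', Fin.cons_zero, Fin.cons_succ, add_apply,
      smul_apply, smul_eq_mul, sum_apply, h1 p hp, h2 p hp]
    rw [← Finset.mul_sum, Finset.sum_add_distrib, ← Finset.mul_sum]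
    have : ∑ i, 2 * w i p * (-κ * (fderiv ℝ r p) (Pi.single i.succ 1))
      = - (2 * κ) * ∑ i, w i p * (fderiv ℝ r p) (Pi.single i.succ 1) := by
      rw [Finset.mul_sum]; exact Finset.sum_congr rfl fun i _ => by ring
    rw [this]
    ring
  let a : Fin (d + 1) → ℝ := Fin.cons 0 (fun i => p i.succ - 1 / 2)
  let b : Fin (d + 1) → ℝ := Fin.cons (p 0) (fun i => p i.succ - 1 / 2 + 1)
  have hab : a ≤ b := by
    intro i
    refine Fin.cases ?_ (fun i => ?_) i
    · simpa [a, b] using hp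
    · simp [a, b]
  have hz : Set.EqOn (fun x => ∑ i, f' i x (Pi.single i 1)) (fun _ => 0) (Set.Icc a b) := by
    intro x hx
    exact hdiv x (by simpa [a] using hx.1 0)
  have key := integral_divergence_of_hasFDerivAt_off_countable' a b hab f f' ∅
    Set.countable_empty (fun i x _ => (hf i x).continuousAt.continuousWithinAt)
    (fun x _ i => hf i x)
    ((integrableOn_congr_fun hz measurableSet_Icc).2 integrableOn_zero)
  rw [setIntegral_congr_fun measurableSet_Icc hz, Fin.sum_univ_succ] at key
  have hside : ∀ i : Fin d, ∀ x : Fin d → ℝ, f i.succ (Fin.insertNth i.succ (b i.succ) x)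
      = f i.succ (Fin.insertNth i.succ (a i.succ) x) := by
    intro i x
    have : (Fin.insertNth i.succ (b i.succ) x : Fin (d + 1) → ℝ)
        = (Fin.insertNth i.succ (a i.succ) x : Fin (d + 1) → ℝ) + Pi.single i.succ 1 := by
      funext k
      refine Fin.succAboveCases i.succ ?_ (fun k => ?_) k
      · simp [a, b]
      · simp [Fin.succAbove_ne]
    simp only [this, f, Fin.cons_succ, hrp, hwp]
  simp only [hside, sub_self, Finset.sum_const_zero, add_zero, integral_zero] at key
  have hinit : ∀ x : Fin d → ℝ, f 0 (Fin.insertNth 0 (a 0) x) = 0 := by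
    intro x
    have h0 : (Fin.insertNth 0 (a 0) x : Fin (d + 1) → ℝ) 0 = 0 := by simp [a]
    simp only [f, e, Fin.cons_zero, hr0 _ h0, hw0 _ _ h0]
    simp
  simp only [hinit, integral_zero, sub_zero] at key
  have hnn : ∀ p, 0 ≤ e p := fun p => by
    have := Finset.sum_nonneg (s := Finset.univ) (fun j _ => sq_nonneg (w j p))
    positivity
  have hcont : Continuous fun x : Fin d → ℝ => e (Fin.cons (p 0) x) := by
    refine hec.comp (continuous_pi fun k => ?_)
    refine Fin.cases ?_ (fun k => ?_) k
    · simpa using continuous_const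
    · simpa using continuous_apply k
  have hfe : ∀ x : Fin d → ℝ, f 0 (Fin.insertNth 0 (b 0) x) = e (Fin.cons (p 0) x) := by
    intro x; simp [f, b]
  simp only [hfe] at key
  have hae := (setIntegral_eq_zero_iff_of_nonneg_ae
    (Filter.Eventually.of_forall fun x => hnn _)
    (hcont.continuousOn.integrableOn_compact isCompact_Icc)).1 key.symm
  have hU : Metric.ball (Fin.tail p) (1 / 2) ⊆
      Set.Icc (a ∘ Fin.succAbove 0) (b ∘ Fin.succAbove 0) := by
    intro x hx
    have hx' : ∀ i, |x i - p i.succ| < 1 / 2 := by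
      intro i
      have := (dist_pi_lt_iff (by norm_num)).1 (Metric.mem_ball.1 hx) i
      simpa [Real.dist_eq, Fin.tail] using this
    constructor <;> intro i <;> have := abs_lt.1 (hx' i) <;> simp [a, b] <;> linarith
  have heq := Measure.eqOn_open_of_ae_eq (ae_restrict_of_ae_restrict_of_subset hU hae)
    Metric.isOpen_ball hcont.continuousOn continuousOn_const
    (Metric.mem_ball_self (by norm_num : (0 : ℝ) < 1 / 2))
  have hep : e p = 0 := by
    have h : (Fin.cons (p 0) (Fin.tail p) : Fin (d + 1) → ℝ) = p := Fin.cons_self_tail p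
    simpa [h] using heq
  have hS := Finset.sum_nonneg (s := Finset.univ) (fun j _ => sq_nonneg (w j p))
  have hr2 : r p ^ 2 = 0 := by
    have : κ * r p ^ 2 + β * ∑ j, w j p ^ 2 = 0 := hep
    have h3 := mul_nonneg hβ.le hS
    nlinarith [sq_nonneg (r p)]
  have hw2 : ∑ j, w j p ^ 2 = 0 := by
    have : κ * r p ^ 2 + β * ∑ j, w j p ^ 2 = 0 := hep
    rw [hr2] at this
    simpa [hβ.ne'] using this
  refine ⟨by simpa using hr2, fun j => ?_⟩
  have := (Finset.sum_eq_zero_iff_of_nonneg (fun j _ => sq_nonneg (w j p))).1 hw2 j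
    (Finset.mem_univ j)
  simpa using this

/-- Moving-frame map. -/
noncomputable def frameMap {d : ℕ} (v : Fin d → ℝ) :
    (Fin (d + 1) → ℝ) →L[ℝ] ℝ × (Fin d → ℝ) :=
  (ContinuousLinearMap.proj 0).prod
    (ContinuousLinearMap.pi fun i => ContinuousLinearMap.proj i.succ
      + v i • ContinuousLinearMap.proj 0)

theorem frameMap_apply {d : ℕ} (v : Fin d → ℝ) (p : Fin (d + 1) → ℝ) :
    frameMap v p = (p 0, fun i => p i.succ + v i * p 0) := by
  rfl

theorem fderiv_slice {d : ℕ} (g : ℝ → (Fin d → ℝ) → ℝ)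
    (hg : Differentiable ℝ (fun p : ℝ × (Fin d → ℝ) => g p.1 p.2)) (t τ : ℝ) (y v : Fin d → ℝ) :
    fderiv ℝ (fun p : ℝ × (Fin d → ℝ) => g p.1 p.2) (t, y) (τ, v)
      = τ * deriv (fun s => g s y) t + adv v (g t) y := by
  have hG := (hg (t, y)).hasFDerivAt
  have ht : deriv (fun s => g s y) t
      = fderiv ℝ (fun p : ℝ × (Fin d → ℝ) => g p.1 p.2) (t, y) (1, 0) := by
    have h := hG.comp_hasDerivAt t ((hasDerivAt_id t).prodMk (hasDerivAt_const t y))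
    exact h.deriv
  have hx : fderiv ℝ (g t) y = (fderiv ℝ (fun p : ℝ × (Fin d → ℝ) => g p.1 p.2) (t, y)).comp
      (ContinuousLinearMap.inr ℝ ℝ (Fin d → ℝ)) := by
    have h := HasFDerivAt.comp y hG (hasFDerivAt_prodMk_right t y)
    exact h.fderiv
  have ha : adv v (g t) y = fderiv ℝ (g t) y v := by
    conv_rhs => rw [← Finset.univ_sum_single v, map_sum]
    refine Finset.sum_congr rfl fun i _ => ?_
    have : (Pi.single i (v i) : Fin d → ℝ) = v i • Pi.single i 1 := by
      rw [← Pi.single_smul]; simp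
    rw [this, map_smul]; rfl
  rw [ha, hx, ht]
  have : ((τ, v) : ℝ × (Fin d → ℝ)) = τ • ((1, 0) : ℝ × (Fin d → ℝ)) + (0, v) := by simp
  rw [this, map_add, map_smul]
  simp

theorem fderiv_frame {d : ℕ} (g : ℝ → (Fin d → ℝ) → ℝ)
    (hg : Differentiable ℝ (fun p : ℝ × (Fin d → ℝ) => g p.1 p.2)) (v : Fin d → ℝ)
    (p q : Fin (d + 1) → ℝ) :
    fderiv ℝ (fun p => g (p 0) (fun i => p i.succ + v i * p 0)) p q
      = q 0 * deriv (fun s => g s (fun i => p i.succ + v i * p 0)) (p 0)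
        + adv (fun i => q i.succ + v i * q 0) (g (p 0)) (fun i => p i.succ + v i * p 0) := by
  have h := (hg (frameMap v p)).hasFDerivAt.comp p (frameMap v).hasFDerivAt
  have h2 : ((fun p : ℝ × (Fin d → ℝ) => g p.1 p.2) ∘ frameMap v)
      = fun p => g (p 0) (fun i => p i.succ + v i * p 0) := by
    funext p; simp [frameMap_apply]
  rw [h2] at h
  rw [h.fderiv, ContinuousLinearMap.comp_apply, frameMap_apply, frameMap_apply, fderiv_slice g hg]

theorem diff_frame {d : ℕ} (g : ℝ → (Fin d → ℝ) → ℝ)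
    (hg : Differentiable ℝ (fun p : ℝ × (Fin d → ℝ) => g p.1 p.2)) (v : Fin d → ℝ) :
    Differentiable ℝ (fun p : Fin (d + 1) → ℝ => g (p 0) (fun i => p i.succ + v i * p 0)) := by
  have h := hg.comp (frameMap v).differentiable
  have h2 : ((fun p : ℝ × (Fin d → ℝ) => g p.1 p.2) ∘ frameMap v)
      = fun p => g (p 0) (fun i => p i.succ + v i * p 0) := by
    funext p; simp [frameMap_apply]
  rwa [h2] at h

theorem adv_single {d : ℕ} (i : Fin d) (f : (Fin d → ℝ) → ℝ) (x : Fin d → ℝ) :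
    adv (Pi.single i 1) f x = pd i f x := by
  simp [adv, Pi.single_apply]

theorem fderiv_frame_time {d : ℕ} (g : ℝ → (Fin d → ℝ) → ℝ)
    (hg : Differentiable ℝ (fun p : ℝ × (Fin d → ℝ) => g p.1 p.2)) (v : Fin d → ℝ)
    (p : Fin (d + 1) → ℝ) :
    fderiv ℝ (fun p => g (p 0) (fun i => p i.succ + v i * p 0)) p (Pi.single 0 1)
      = deriv (fun s => g s (fun i => p i.succ + v i * p 0)) (p 0)
        + adv v (g (p 0)) (fun i => p i.succ + v i * p 0) := by
  rw [fderiv_frame g hg]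
  simp

theorem fderiv_frame_space {d : ℕ} (g : ℝ → (Fin d → ℝ) → ℝ)
    (hg : Differentiable ℝ (fun p : ℝ × (Fin d → ℝ) => g p.1 p.2)) (v : Fin d → ℝ)
    (p : Fin (d + 1) → ℝ) (i : Fin d) :
    fderiv ℝ (fun p => g (p 0) (fun i => p i.succ + v i * p 0)) p (Pi.single i.succ 1)
      = pd i (g (p 0)) (fun i => p i.succ + v i * p 0) := by
  rw [fderiv_frame g hg]
  have : (fun k : Fin d => (Pi.single i.succ 1 : Fin (d + 1) → ℝ) k.succ
      + v k * (Pi.single i.succ 1 : Fin (d + 1) → ℝ) 0) = Pi.single i 1 := by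
    funext k
    simp [Pi.single_apply]
  rw [this, adv_single]
  simp

/-- Invariance of the well-prepared space under the linear wave equation system with
advection: if the initial density is spatially constant and the initial velocity is
divergence-free, then for all `t ≥ 0` the density stays spatially constant and the
velocity stays divergence-free. -/
theorem stmt_3 (d : ℕ) (hd : 1 ≤ d) (ε ρb ab : ℝ) (hε : 0 < ε) (hρb : 0 < ρb)
    (hab : 0 < ab) (ub : Fin d → ℝ)
    (ρ : ℝ → (Fin d → ℝ) → ℝ) (u : ℝ → (Fin d → ℝ) → Fin d → ℝ)
    (hρC : ContDiff ℝ (⊤ : ℕ∞) (fun p : ℝ × (Fin d → ℝ) => ρ p.1 p.2))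
    (huC : ContDiff ℝ (⊤ : ℕ∞) (fun p : ℝ × (Fin d → ℝ) => u p.1 p.2))
    (hρper : ∀ (t : ℝ) (x : Fin d → ℝ) (k : Fin d → ℤ),
      ρ t (fun i => x i + (k i : ℝ)) = ρ t x)
    (huper : ∀ (t : ℝ) (x : Fin d → ℝ) (k : Fin d → ℤ),
      u t (fun i => x i + (k i : ℝ)) = u t x)
    (hmass : ∀ (t : ℝ), 0 ≤ t → ∀ (x : Fin d → ℝ),
      deriv (fun s => ρ s x) t + adv ub (ρ t) x + ρb * dvg (u t) x = 0)
    (hmom : ∀ (t : ℝ), 0 ≤ t → ∀ (x : Fin d → ℝ) (j : Fin d),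
      deriv (fun s => u s x j) t + adv ub (fun y => u t y j) x
        + (ab ^ 2 / (ρb * ε ^ 2)) * pd j (ρ t) x = 0)
    (hρ0 : ∀ x y : Fin d → ℝ, ρ 0 x = ρ 0 y)
    (hu0 : ∀ x : Fin d → ℝ, dvg (u 0) x = 0) :
    ∀ t : ℝ, 0 ≤ t →
      (∀ x y : Fin d → ℝ, ρ t x = ρ t y) ∧ (∀ x : Fin d → ℝ, dvg (u t) x = 0) := by
  have hρD : Differentiable ℝ (fun p : ℝ × (Fin d → ℝ) => ρ p.1 p.2) :=
    hρC.differentiable (by simp)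
  have huD : ∀ j, Differentiable ℝ (fun p : ℝ × (Fin d → ℝ) => u p.1 p.2 j) := fun j =>
    differentiable_pi.1 (huC.differentiable (by simp)) j
  have hu0D : ∀ j, Differentiable ℝ (fun p : ℝ × (Fin d → ℝ) => u 0 p.2 j) := fun j =>
    (huD j).comp (f := fun p : ℝ × (Fin d → ℝ) => ((0 : ℝ), p.2)) (by fun_prop)
  let r : (Fin (d + 1) → ℝ) → ℝ := fun p => ρ (p 0) (fun i => p i.succ + ub i * p 0) - ρ 0 0
  let w1 : Fin d → (Fin (d + 1) → ℝ) → ℝ := fun j p =>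
    u (p 0) (fun i => p i.succ + ub i * p 0) j
  let w2 : Fin d → (Fin (d + 1) → ℝ) → ℝ := fun j p =>
    u 0 (fun i => p i.succ + (0 : Fin d → ℝ) i * p 0) j
  have hd1 : ∀ j, Differentiable ℝ (w1 j) := fun j =>
    diff_frame (fun t x => u t x j) (huD j) ub
  have hd2 : ∀ j, Differentiable ℝ (w2 j) := fun j =>
    diff_frame (fun _ x => u 0 x j) (hu0D j) 0
  have hfr : ∀ p, fderiv ℝ r p
      = fderiv ℝ (fun p => ρ (p 0) (fun i => p i.succ + ub i * p 0)) p := fun p =>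
    fderiv_sub_const _
  have hfw : ∀ j p, fderiv ℝ (w1 j - w2 j) p = fderiv ℝ (w1 j) p - fderiv ℝ (w2 j) p :=
    fun j p => fderiv_sub (hd1 j p) (hd2 j p)
  have hsh : ∀ (v : Fin d → ℝ) (p : Fin (d + 1) → ℝ) (i : Fin d),
      (fun k : Fin d => (p + Pi.single i.succ 1 : Fin (d + 1) → ℝ) k.succ + v k * p 0)
      = fun k => (fun k : Fin d => p k.succ + v k * p 0) k
        + (((Pi.single i 1 : Fin d → ℤ) k : ℤ) : ℝ) := by
    intro v p i
    funext k
    by_cases h : k = i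
    · subst h; simp; ring
    · simp [h]
  have hp0 : ∀ (p : Fin (d + 1) → ℝ) (i : Fin d),
      (p + Pi.single i.succ 1 : Fin (d + 1) → ℝ) 0 = p 0 := by
    intro p i; simp
  have hκ : 0 < ab ^ 2 / (ρb * ε ^ 2) := by positivity
  have key := energy_zero (ab ^ 2 / (ρb * ε ^ 2)) ρb hκ hρb r (fun j => w1 j - w2 j)
    ((diff_frame ρ hρD ub).sub_const _) (fun j => (hd1 j).sub (hd2 j))
    (by
      intro p i
      simp only [r, hp0]
      rw [hsh, hρper])
    (by
      intro j p i
      simp only [w1, w2, Pi.sub_apply, hp0]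
      rw [hsh, hsh, huper, huper])
    (by
      intro p hp
      simp only [r, hp]
      rw [hρ0 _ 0, sub_self])
    (by
      intro j p hp
      simp [w1, w2, hp])
    (by
      intro p hp
      have e1 := fderiv_frame_time ρ hρD ub p
      rw [hfr, e1]
      have e2 : ∑ i : Fin d, fderiv ℝ (w1 i - w2 i) p (Pi.single i.succ 1)
          = dvg (u (p 0)) (fun i => p i.succ + ub i * p 0)
            - dvg (u 0) (fun i => p i.succ + (0 : Fin d → ℝ) i * p 0) := by
        simp only [dvg]
        rw [← Finset.sum_sub_distrib]
        refine Finset.sum_congr rfl fun i _ => ?_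
        rw [hfw]
        exact congrArg₂ (· - ·) (fderiv_frame_space (fun t x => u t x i) (huD i) ub p i)
          (fderiv_frame_space (fun _ x => u 0 x i) (hu0D i) 0 p i)
      rw [e2, hu0]
      linarith [hmass (p 0) hp (fun i => p i.succ + ub i * p 0)])
    (by
      intro p hp j
      rw [hfr, hfw, fderiv_frame_space ρ hρD ub p j]
      have e1 : fderiv ℝ (w1 j) p (Pi.single 0 1) = _ :=
        fderiv_frame_time (fun t x => u t x j) (huD j) ub p
      have e2 : fderiv ℝ (w2 j) p (Pi.single 0 1) = _ :=
        fderiv_frame_time (fun _ x => u 0 x j) (hu0D j) 0 p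
      have e3 : fderiv ℝ (w2 j) p (Pi.single 0 1) = 0 := by
        rw [e2]; simp [adv]
      have e4 : (fderiv ℝ (w1 j) p - fderiv ℝ (w2 j) p) (Pi.single 0 1)
        = fderiv ℝ (w1 j) p (Pi.single 0 1) - fderiv ℝ (w2 j) p (Pi.single 0 1) := rfl
      rw [e4, e3, e1]
      linarith [hmom (p 0) hp (fun i => p i.succ + ub i * p 0) j])
  intro t ht
  have hpt : ∀ x : Fin d → ℝ, ρ t x = ρ 0 0 ∧ ∀ j, u t x j = u 0 (x - t • ub) j := by
    intro x
    have hk := key (Fin.cons t (x - t • ub)) (by simpa using ht)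
    have hx : (fun i => x i - t * ub i + ub i * t) = x := by funext i; ring
    have hx2 : (fun i => x i - t * ub i) = x - t • ub := by funext i; simp
    simp only [r, w1, w2, Pi.sub_apply, Fin.cons_zero, Fin.cons_succ, Pi.smul_apply, smul_eq_mul,
      Pi.zero_apply, zero_mul, add_zero, hx, hx2, sub_eq_zero] at hk
    exact hk
  refine ⟨fun x y => (hpt x).1.trans (hpt y).1.symm, fun x => ?_⟩
  rw [← hu0 (x - t • ub)]
  simp only [dvg, pd]
  refine Finset.sum_congr rfl fun i _ => ?_
  have : (fun y => u t y i) = fun y => (fun z => u 0 z i) (y - t • ub) := by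
    funext y; exact (hpt y).2 i
  rw [this]
  rw [fderiv_comp_sub (𝕜 := ℝ) (f := fun z => u 0 z i) (x := x) (t • ub)]
end

section
/- Let d ≥ 1, and let ε, ρ̄, ā, Δt > 0, let ū ∈ ℝ^d be a constant vector, and let β₁, β₂, β₃, β₄, κ₁, κ₂, κ₃, κ₄ be arbitrary real coefficients. Let ρ : [0,∞) × ℝ^d → ℝ and u : [0,∞) × ℝ^d → ℝ^d be smooth, ℤ^d-periodic in space, and solve pointwise the modified equation system of the second-order IMEX-RK semi-discrete scheme for the wave equation: ∂_t ρ + ū·∇ρ + ρ̄ (∇·u) = Δt² [ β₂ (ū·∇)³ρ + β₃ (ā²/ε²)(ū·∇)Δρ + β₁ ρ̄ (ū·∇)²(∇·u) + β₄ (ā² ρ̄/ε²) Δ(∇·u) ] + Δt³ [ κ₁ (ā²/ε²)(ū·∇)²Δρ + κ₄ (ā⁴/ε⁴) Δ²ρ − (1/24)(ū·∇)⁴ρ + κ₂ ρ̄ (ū·∇)³(∇·u) + κ₃ (ā² ρ̄/ε²)(ū·∇)Δ(∇·u) ], and ∂_t u + (ū·∇)u + (ā²/(ρ̄ ε²)) ∇ρ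 = Δt² [ β₁ (ā²/ε²)(ū·∇)²∇ρ + β₄ (ā⁴/(ρ̄ ε⁴)) Δ∇ρ + β₂ (ū·∇)³u + β₃ (ā²/ε²)(ū·∇)∇(∇·u) ] + Δt³ [ κ₂ (ā²/(ρ̄ ε²))(ū·∇)³∇ρ + κ₃ (ā⁴/(ρ̄ ε⁴))(ū·∇)Δ∇ρ + κ₁ (ā²/ε²)(ū·∇)²∇(∇·u) + κ₄ (ā⁴/ε⁴) ∇Δ(∇·u) − (1/24)(ū·∇)⁴u ]. If ρ(0,·) is spatially constant and ∇·u(0,·) ≡ 0, then for every t ≥ 0, ρ(t,·) is spatially constant and ∇·u(t,·) ≡ 0. -/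
/-- Laplacian `Δf = Σᵢ ∂²f/∂xᵢ²` of a scalar function on `ℝ^d`. -/
noncomputable def lap {d : ℕ} (f : (Fin d → ℝ) → ℝ) : (Fin d → ℝ) → ℝ :=
  fun x => ∑ i, pd i (pd i f) x

open MeasureTheory Set Filter Topology

/-- smooth periodic functions -/
def SP {d : ℕ} (f : (Fin d → ℝ) → ℝ) : Prop :=
  ContDiff ℝ (⊤ : ℕ∞) f ∧ ∀ (x : Fin d → ℝ) (k : Fin d → ℤ), f (fun i => x i + (k i : ℝ)) = f x

lemma SP.hpd {d : ℕ} {f : (Fin d → ℝ) → ℝ} (hf : SP f) (i : Fin d) : SP (pd i f) := by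
  refine ⟨?_, ?_⟩
  · have h := hf.1.fderiv_right (m := ((⊤ : ℕ∞) : WithTop ℕ∞)) (by simp)
    exact h.clm_apply contDiff_const
  · intro x k
    unfold pd
    have h1 : (fun y : Fin d → ℝ => f (y + fun i => (k i : ℝ))) = f := by
      funext y; exact hf.2 y k
    have h2 := fderiv_comp_add_right (𝕜 := ℝ) (f := f) (x := x) (fun i => (k i : ℝ))
    rw [h1] at h2
    rw [h2]; rfl

lemma SP.const_mul {d : ℕ} {f : (Fin d → ℝ) → ℝ} (hf : SP f) (a : ℝ) : SP (fun x => a * f x) :=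
  ⟨contDiff_const.mul hf.1, fun x k => by simp only [hf.2 x k]⟩

lemma SP.add {d : ℕ} {f g : (Fin d → ℝ) → ℝ} (hf : SP f) (hg : SP g) : SP (fun x => f x + g x) :=
  ⟨hf.1.add hg.1, fun x k => by simp only [hf.2 x k, hg.2 x k]⟩

lemma SP.sub {d : ℕ} {f g : (Fin d → ℝ) → ℝ} (hf : SP f) (hg : SP g) : SP (fun x => f x - g x) :=
  ⟨hf.1.sub hg.1, fun x k => by simp only [hf.2 x k, hg.2 x k]⟩

lemma SP.sum {d : ℕ} {f : Fin d → (Fin d → ℝ) → ℝ} (hf : ∀ i, SP (f i)) :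
    SP (fun x => ∑ i, f i x) :=
  ⟨ContDiff.sum fun i _ => (hf i).1, fun x k => by simp only [fun i => (hf i).2 x k]⟩

/-- exponential weight -/
noncomputable def ek {d : ℕ} (k : Fin d → ℤ) (x : Fin d → ℝ) : ℂ :=
  Complex.exp (∑ i, (-(2 * Real.pi * Complex.I * (k i : ℂ))) * (x i : ℂ))

noncomputable def ck {d : ℕ} (k : Fin d → ℤ) (f : (Fin d → ℝ) → ℝ) : ℂ :=
  ∫ x in Icc (0 : Fin d → ℝ) 1, (f x : ℂ) * ek k x

/-- symbol of the partial derivative -/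
noncomputable def sy {d : ℕ} (k : Fin d → ℤ) (i : Fin d) : ℂ := 2 * Real.pi * Complex.I * (k i : ℂ)

lemma ek_contDiff {d : ℕ} (k : Fin d → ℤ) : ContDiff ℝ (⊤ : ℕ∞) (ek k) := by
  unfold ek
  have : ∀ i : Fin d, ContDiff ℝ (⊤ : ℕ∞) (fun x : Fin d → ℝ => ((x i : ℝ) : ℂ)) := fun i =>
    Complex.ofRealCLM.contDiff.comp (contDiff_apply ℝ ℝ i)
  exact (ContDiff.sum fun i _ => contDiff_const.mul (this i)).cexp

lemma ek_add {d : ℕ} (k : Fin d → ℤ) (x : Fin d → ℝ) (m : Fin d → ℤ) :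
    ek k (fun i => x i + (m i : ℝ)) = ek k x := by
  unfold ek
  rw [Complex.exp_eq_exp_iff_exists_int]
  refine ⟨∑ i, -(k i * m i), ?_⟩
  push_cast
  rw [Finset.sum_mul, ← Finset.sum_add_distrib]
  refine Finset.sum_congr rfl fun i _ => ?_
  ring

lemma ek_fderiv {d : ℕ} (k : Fin d → ℤ) (x : Fin d → ℝ) (i : Fin d) :
    fderiv ℝ (ek k) x (Pi.single i 1) = - sy k i * ek k x := by
  have h0 : ∀ j : Fin d, HasFDerivAt (fun x : Fin d → ℝ => ((x j : ℝ) : ℂ))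
      (Complex.ofRealCLM.comp (ContinuousLinearMap.proj (R := ℝ) (φ := fun _ : Fin d => ℝ) j)) x :=
    fun j => (Complex.ofRealCLM.comp
      (ContinuousLinearMap.proj (R := ℝ) (φ := fun _ : Fin d => ℝ) j)).hasFDerivAt
  have h1 := (HasFDerivAt.fun_sum (u := Finset.univ)
    fun j _ => (h0 j).const_mul (-(2 * Real.pi * Complex.I * (k j : ℂ)))).cexp
  have h2 : HasFDerivAt (ek k) _ x := h1
  rw [h2.fderiv]
  simp only [smul_apply, sum_apply,
    ContinuousLinearMap.comp_apply, ContinuousLinearMap.proj_apply, Complex.ofRealCLM_apply,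
    Pi.single_apply, smul_eq_mul]
  unfold ek
  rw [mul_comm (-sy k i)]
  congr 1
  rw [Finset.sum_eq_single i]
  · unfold sy
    simp only [if_true, Complex.ofReal_one]
    ring
  · intro j _ hj; simp [hj]
  · simp

lemma ck_integrable {d : ℕ} (k : Fin d → ℤ) {f : (Fin d → ℝ) → ℝ} (hf : SP f) :
    IntegrableOn (fun x => (f x : ℂ) * ek k x) (Icc (0 : Fin d → ℝ) 1) := by
  apply Continuous.integrableOn_Icc
  exact (Complex.continuous_ofReal.comp hf.1.continuous).mul (ek_contDiff k).continuous

lemma int_pd_zero {d : ℕ} (g : (Fin d → ℝ) → ℂ) (hg : ContDiff ℝ (⊤ : ℕ∞) g)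
    (hper : ∀ (x : Fin d → ℝ) (k : Fin d → ℤ), g (fun i => x i + (k i : ℝ)) = g x) (i : Fin d) :
    ∫ x in Icc (0 : Fin d → ℝ) 1, fderiv ℝ g x (Pi.single i 1) = 0 := by
  obtain _ | n := d
  · exact i.elim0
  have hc : Continuous (fun x => fderiv ℝ g x (Pi.single i 1)) :=
    (hg.continuous_fderiv (by simp)).clm_apply continuous_const
  have hsum : ∀ x : Fin (n+1) → ℝ, ∑ j, (if j = i then fderiv ℝ g x else 0) (Pi.single j 1)
      = fderiv ℝ g x (Pi.single i 1) := by
    intro x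
    rw [Finset.sum_eq_single i]
    · simp
    · intro j _ hj; simp [hj]
    · simp
  have key := integral_divergence_of_hasFDerivAt_off_countable' (n := n) (E := ℂ)
    (0 : Fin (n+1) → ℝ) 1 zero_le_one
    (fun j => if j = i then g else 0) (fun j x => if j = i then fderiv ℝ g x else 0) ∅
    countable_empty
    (by intro j; by_cases h : j = i
        · simpa [h] using hg.continuous.continuousOn
        · simp only [h, if_false]; exact continuousOn_const)
    (by intro x _ j; by_cases h : j = i
        · simpa [h] using (hg.differentiable (by simp) x).hasFDerivAt
        · simp only [h, if_false]; exact hasFDerivAt_const _ _)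
    (by simp only [hsum]; exact hc.integrableOn_Icc)
  simp only [hsum] at key
  rw [key]
  apply Finset.sum_eq_zero
  intro j _
  by_cases h : j = i
  · subst h
    simp only [if_true]
    rw [sub_eq_zero]
    congr 1
    funext x
    have := hper (j.insertNth ((0 : Fin (n+1) → ℝ) j) x) (Pi.single j 1)
    rw [← this]
    congr 1
    funext l
    refine Fin.succAboveCases j ?_ ?_ l
    · simp
    · intro m; simp
  · simp [h]

lemma ck_pd {d : ℕ} (k : Fin d → ℤ) {f : (Fin d → ℝ) → ℝ} (hf : SP f) (i : Fin d) :
    ck k (pd i f) = sy k i * ck k f := by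
  have hfC : ContDiff ℝ (⊤ : ℕ∞) (fun x => (f x : ℂ)) := Complex.ofRealCLM.contDiff.comp hf.1
  have h := int_pd_zero (fun x => (f x : ℂ) * ek k x) (hfC.mul (ek_contDiff k))
    (fun x m => by simp only [hf.2 x m, ek_add]) i
  have h2 : ∀ x, fderiv ℝ (fun x => (f x : ℂ) * ek k x) x (Pi.single i 1)
      = (pd i f x : ℂ) * ek k x - sy k i * ((f x : ℂ) * ek k x) := by
    intro x
    rw [fderiv_fun_mul (hfC.differentiable (by simp) x)
      ((ek_contDiff k).differentiable (by simp) x)]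
    have h3 : HasFDerivAt (fun x => (f x : ℂ)) _ x :=
      Complex.ofRealCLM.hasFDerivAt.comp x (hf.1.differentiable (by simp) x).hasFDerivAt
    simp only [add_apply, smul_apply, ek_fderiv, h3.fderiv]
    simp [pd]
    ring
  simp only [h2] at h
  rw [integral_sub (ck_integrable k (hf.hpd i)) ((ck_integrable k hf).const_mul _),
    integral_const_mul, sub_eq_zero] at h
  exact h

/-- `f` is smooth periodic with `k`-th Fourier coefficient `z`. -/
def HC {d : ℕ} (k : Fin d → ℤ) (f : (Fin d → ℝ) → ℝ) (z : ℂ) : Prop := SP f ∧ ck k f = z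

section HC
variable {d : ℕ} {k : Fin d → ℤ} {f g : (Fin d → ℝ) → ℝ} {z w : ℂ}

lemma HC.hpd (h : HC k f z) (i : Fin d) : HC k (pd i f) (sy k i * z) :=
  ⟨h.1.hpd i, by rw [ck_pd k h.1, h.2]⟩

lemma HC.mul (a : ℝ) (h : HC k f z) : HC k (fun x => a * f x) (a * z) :=
  ⟨h.1.const_mul a, by
    rw [← h.2]; unfold ck; rw [← integral_const_mul]; congr 1; funext x; push_cast; ring⟩

lemma HC.add (h : HC k f z) (h' : HC k g w) : HC k (fun x => f x + g x) (z + w) :=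
  ⟨h.1.add h'.1, by
    rw [← h.2, ← h'.2]; unfold ck
    rw [← integral_add (ck_integrable k h.1) (ck_integrable k h'.1)]
    congr 1; funext x; push_cast; ring⟩

lemma HC.sub (h : HC k f z) (h' : HC k g w) : HC k (fun x => f x - g x) (z - w) :=
  ⟨h.1.sub h'.1, by
    rw [← h.2, ← h'.2]; unfold ck
    rw [← integral_sub (ck_integrable k h.1) (ck_integrable k h'.1)]
    congr 1; funext x; push_cast; ring⟩

lemma HC.sum {F : Fin d → (Fin d → ℝ) → ℝ} {Z : Fin d → ℂ} (h : ∀ i, HC k (F i) (Z i)) :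
    HC k (fun x => ∑ i, F i x) (∑ i, Z i) :=
  ⟨SP.sum fun i => (h i).1, by
    simp only [← fun i => (h i).2]; unfold ck
    rw [← integral_finsetSum _ (fun i _ => ck_integrable k (h i).1)]
    congr 1; funext x; push_cast; rw [Finset.sum_mul]⟩

lemma HC.hadv (v : Fin d → ℝ) (h : HC k f z) : HC k (adv v f) ((∑ i, (v i : ℂ) * sy k i) * z) := by
  have := HC.sum fun i => (h.hpd i).mul (v i)
  rw [Finset.sum_mul]
  simpa only [mul_assoc] using! this

lemma HC.hlap (h : HC k f z) : HC k (lap f) ((∑ i, sy k i * sy k i) * z) := by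
  have := HC.sum fun i => (h.hpd i).hpd i
  rw [Finset.sum_mul]
  simpa only [mul_assoc] using! this

lemma HC.hdvg {u : (Fin d → ℝ) → Fin d → ℝ} {Z : Fin d → ℂ}
    (h : ∀ i, HC k (fun y => u y i) (Z i)) : HC k (dvg u) (∑ i, sy k i * Z i) :=
  HC.sum fun i => (h i).hpd i
end HC

lemma ck_hasDerivAt {d : ℕ} (k : Fin d → ℤ) (F : ℝ → (Fin d → ℝ) → ℝ)
    (hF : ContDiff ℝ (⊤ : ℕ∞) (fun p : ℝ × (Fin d → ℝ) => F p.1 p.2)) (t : ℝ) :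
    HasDerivAt (fun s => ck k (F s)) (ck k (fun x => deriv (fun s => F s x) t)) t := by
  have hd : ∀ s x, HasDerivAt (fun s => F s x)
      (fderiv ℝ (fun p : ℝ × (Fin d → ℝ) => F p.1 p.2) (s, x) (1, 0)) s := by
    intro s x
    have h1 := (hF.differentiable (by simp) (s, x)).hasFDerivAt
    have h2 : HasDerivAt (fun s : ℝ => (s, x)) ((1 : ℝ), (0 : Fin d → ℝ)) s :=
      (hasDerivAt_id s).prodMk (hasDerivAt_const s x)
    exact h1.comp_hasDerivAt s h2
  have hcont : Continuous (fun p : ℝ × (Fin d → ℝ) =>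
      fderiv ℝ (fun p : ℝ × (Fin d → ℝ) => F p.1 p.2) p (1, 0)) :=
    (hF.continuous_fderiv (by simp)).clm_apply continuous_const
  set G := fun p : ℝ × (Fin d → ℝ) =>
      fderiv ℝ (fun p : ℝ × (Fin d → ℝ) => F p.1 p.2) p (1, 0) with hG
  have hder : ∀ s x, deriv (fun s => F s x) s = G (s, x) := fun s x => (hd s x).deriv
  have hGc : Continuous (fun p : ℝ × (Fin d → ℝ) => (G p : ℂ) * ek k p.2) :=
    (Complex.continuous_ofReal.comp hcont).mul ((ek_contDiff k).continuous.comp continuous_snd)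
  obtain ⟨C, hC⟩ := ((isCompact_Icc (a := t - 1) (b := t + 1)).prod
    (isCompact_Icc (a := (0 : Fin d → ℝ)) (b := 1))).exists_bound_of_continuousOn hGc.continuousOn
  have hcF : ∀ s, Continuous (fun x => (F s x : ℂ) * ek k x) := fun s =>
    (Complex.continuous_ofReal.comp (hF.continuous.comp
      (Continuous.prodMk continuous_const continuous_id))).mul (ek_contDiff k).continuous
  have key := hasDerivAt_integral_of_dominated_loc_of_deriv_le (𝕜 := ℝ)
    (μ := volume.restrict (Icc (0 : Fin d → ℝ) 1))
    (F := fun s x => (F s x : ℂ) * ek k x) (F' := fun s x => (G (s, x) : ℂ) * ek k x)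
    (x₀ := t) (s := Icc (t - 1) (t + 1)) (bound := fun _ => C)
    (Icc_mem_nhds (by linarith) (by linarith))
    (Eventually.of_forall fun s => (hcF s).aestronglyMeasurable)
    ((hcF t).integrableOn_Icc)
    ((hGc.comp (Continuous.prodMk continuous_const continuous_id)).aestronglyMeasurable)
    (by
      refine (ae_restrict_iff' measurableSet_Icc).2 (Eventually.of_forall fun x hx s hs => ?_)
      exact hC (s, x) ⟨hs, hx⟩)
    ((continuous_const (y := C)).integrableOn_Icc)
    (Eventually.of_forall fun x s _ => ((hd s x).ofReal_comp.mul_const (ek k x)))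
  unfold ck
  simp only [hder]
  exact key.2

lemma ode_zero (A B C E : ℂ) (a D : ℝ → ℂ)
    (ha : ∀ t, 0 ≤ t → HasDerivAt a (A * a t + B * D t) t)
    (hD : ∀ t, 0 ≤ t → HasDerivAt D (C * a t + E * D t) t)
    (ha0 : a 0 = 0) (hD0 : D 0 = 0) (t : ℝ) (ht : 0 ≤ t) : a t = 0 ∧ D t = 0 := by
  have hder : ∀ s, 0 ≤ s → HasDerivAt (fun s => (a s, D s))
      (A * a s + B * D s, C * a s + E * D s) s := fun s hs => (ha s hs).prodMk (hD s hs)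
  have := eq_zero_of_abs_deriv_le_mul_abs_self_of_eq_zero_right (a := 0) (b := t)
    (f := fun s => (a s, D s)) (f' := fun s => (A * a s + B * D s, C * a s + E * D s))
    (K := ‖A‖ + ‖B‖ + ‖C‖ + ‖E‖)
    (fun s hs => (hder s hs.1).continuousAt.continuousWithinAt)
    (fun s hs => (hder s hs.1).hasDerivWithinAt)
    (by simp [ha0, hD0])
    (by
      intro s hs
      have h1 : ‖a s‖ ≤ ‖(a s, D s)‖ := norm_fst_le (a s, D s)
      have h2 : ‖D s‖ ≤ ‖(a s, D s)‖ := norm_snd_le (a s, D s)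
      set N := ‖(a s, D s)‖
      have hN : 0 ≤ N := (norm_nonneg _).trans h1
      have q : ∀ P Q : ℂ, ‖P * a s + Q * D s‖ ≤ ‖P‖ * N + ‖Q‖ * N := by
        intro P Q
        refine (norm_add_le _ _).trans ?_
        rw [norm_mul, norm_mul]
        gcongr
      refine norm_prod_le_iff.2 ⟨(q A B).trans ?_, (q C E).trans ?_⟩
      · nlinarith [mul_nonneg (norm_nonneg C) hN, mul_nonneg (norm_nonneg E) hN]
      · nlinarith [mul_nonneg (norm_nonneg A) hN, mul_nonneg (norm_nonneg B) hN])
    t ⟨ht, le_rfl⟩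
  exact ⟨congrArg Prod.fst this, congrArg Prod.snd this⟩

lemma torus_measure (d : ℕ) : MeasurePreserving
    (fun (x : Fin d → ℝ) (i : Fin d) => ((x i : ℝ) : UnitAddCircle))
    (volume.restrict (Icc (0 : Fin d → ℝ) 1))
    (Measure.pi fun _ : Fin d => (AddCircle.haarAddCircle : Measure UnitAddCircle)) := by
  have h1 : MeasurePreserving ((↑) : ℝ → UnitAddCircle) (volume.restrict (Ioc (0:ℝ) 1))
      (AddCircle.haarAddCircle : Measure UnitAddCircle) := by
    have h := AddCircle.measurePreserving_mk (1 : ℝ) 0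
    have h2 := AddCircle.volume_eq_smul_haarAddCircle (T := (1:ℝ))
    rw [h2] at h
    simpa using h
  have h3 := measurePreserving_pi (ι := Fin d) (fun _ => volume.restrict (Ioc (0:ℝ) 1))
    (fun _ => (AddCircle.haarAddCircle : Measure UnitAddCircle)) (fun _ => h1)
  rw [← Measure.restrict_pi_pi] at h3
  rw [volume_pi, ← Measure.restrict_congr_set (Measure.univ_pi_Ioc_ae_eq_Icc (μ := fun _ : Fin d => (volume : Measure ℝ)) (f := 0) (g := 1))]
  exact h3

lemma SP.eq_zero {d : ℕ} {f : (Fin d → ℝ) → ℝ} (hf : SP f) (h : ∀ k, ck k f = 0) (x) : f x = 0 := by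
  let π : (Fin d → ℝ) → UnitAddTorus (Fin d) := fun x i => ((x i : ℝ) : UnitAddCircle)
  have hπ : IsOpenQuotientMap π := IsOpenQuotientMap.piMap fun _ =>
    QuotientAddGroup.isOpenQuotientMap_mk
  have hfac : ∀ x y, π x = π y → f x = f y := by
    intro x y hxy
    have : ∀ i, ∃ n : ℤ, y i = x i + n := by
      intro i
      have := congrFun hxy i
      obtain ⟨n, hn⟩ := (QuotientAddGroup.eq_iff_sub_mem.1 this)
      refine ⟨-n, ?_⟩
      simp at hn
      push_cast
      linarith
    choose n hn using this
    rw [show y = fun i => x i + (n i : ℝ) from funext hn, hf.2]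
  let G0 : UnitAddTorus (Fin d) → ℂ := fun y => (f (Function.surjInv hπ.surjective y) : ℂ)
  have hG0 : ∀ x, G0 (π x) = (f x : ℂ) := fun x => by
    simp only [G0]
    rw [hfac _ _ (Function.surjInv_eq hπ.surjective (π x))]
  have hcont : Continuous G0 := by
    rw [hπ.isQuotientMap.continuous_iff]
    have : G0 ∘ π = fun x => (f x : ℂ) := funext hG0
    rw [this]
    exact Complex.continuous_ofReal.comp hf.1.continuous
  let G : C(UnitAddTorus (Fin d), ℂ) := ⟨G0, hcont⟩
  have hek : ∀ k x, UnitAddTorus.mFourier (-k) (π x) = ek k x := by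
    intro k x
    simp only [UnitAddTorus.mFourier, ContinuousMap.coe_mk, π, fourier_coe_apply, ek,
      Complex.exp_sum]
    refine Finset.prod_congr rfl fun i _ => ?_
    congr 1
    simp
  have hcoef : ∀ k, UnitAddTorus.mFourierCoeff G k = 0 := by
    intro k
    have e1 : UnitAddTorus.mFourierCoeff G k = ∫ y, UnitAddTorus.mFourier (-k) y • G0 y
      ∂(Measure.pi fun _ : Fin d => (AddCircle.haarAddCircle : Measure UnitAddCircle)) := rfl
    rw [e1, ← (torus_measure d).map_eq, integral_map (torus_measure d).measurable.aemeasurable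
      (Continuous.aestronglyMeasurable (by fun_prop))]
    rw [← h k]
    unfold ck
    congr 1
    funext x
    have := hek k x
    have h4 := hG0 x
    simp only [π] at this h4
    rw [this, h4, smul_eq_mul, mul_comm]
  have hs := UnitAddTorus.hasSum_mFourier_series_apply_of_summable (f := G)
    (by simp only [funext hcoef]; exact summable_zero) (π x)
  simp only [hcoef, zero_smul] at hs
  have h0 : G (π x) = 0 := hs.unique hasSum_zero
  have h5 : (f x : ℂ) = 0 := by rw [← hG0]; exact h0
  exact_mod_cast h5

/-- Proposition 5.4: the modified PDE of the second-order IMEX-RK time semi-discrete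
scheme applied to the linear wave equation system leaves the well-prepared space
`{(ρ,u) : ∇ρ = 0, ∇·u = 0}` invariant, for arbitrary correction coefficients
`β₁,…,β₄` and `κ₁,…,κ₄`. -/
theorem stmt_4 (d : ℕ) (hd : 1 ≤ d) (ε ρb ab Δt : ℝ)
    (hε : 0 < ε) (hρb : 0 < ρb) (hab : 0 < ab) (hΔt : 0 < Δt)
    (ub : Fin d → ℝ) (β₁ β₂ β₃ β₄ κ₁ κ₂ κ₃ κ₄ : ℝ)
    (ρ : ℝ → (Fin d → ℝ) → ℝ) (u : ℝ → (Fin d → ℝ) → Fin d → ℝ)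
    (hρC : ContDiff ℝ (⊤ : ℕ∞) (fun p : ℝ × (Fin d → ℝ) => ρ p.1 p.2))
    (huC : ContDiff ℝ (⊤ : ℕ∞) (fun p : ℝ × (Fin d → ℝ) => u p.1 p.2))
    (hρper : ∀ (t : ℝ) (x : Fin d → ℝ) (k : Fin d → ℤ),
      ρ t (fun i => x i + (k i : ℝ)) = ρ t x)
    (huper : ∀ (t : ℝ) (x : Fin d → ℝ) (k : Fin d → ℤ),
      u t (fun i => x i + (k i : ℝ)) = u t x)
    (hmass : ∀ (t : ℝ), 0 ≤ t → ∀ (x : Fin d → ℝ),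
      deriv (fun s => ρ s x) t + adv ub (ρ t) x + ρb * dvg (u t) x
        = Δt ^ 2 *
            (β₂ * adv ub (adv ub (adv ub (ρ t))) x
              + β₃ * (ab ^ 2 / ε ^ 2) * adv ub (lap (ρ t)) x
              + β₁ * ρb * adv ub (adv ub (dvg (u t))) x
              + β₄ * (ab ^ 2 * ρb / ε ^ 2) * lap (dvg (u t)) x)
          + Δt ^ 3 *
            (κ₁ * (ab ^ 2 / ε ^ 2) * adv ub (adv ub (lap (ρ t))) x
              + κ₄ * (ab ^ 4 / ε ^ 4) * lap (lap (ρ t)) x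
              - (1 / 24) * adv ub (adv ub (adv ub (adv ub (ρ t)))) x
              + κ₂ * ρb * adv ub (adv ub (adv ub (dvg (u t)))) x
              + κ₃ * (ab ^ 2 * ρb / ε ^ 2) * adv ub (lap (dvg (u t))) x))
    (hmom : ∀ (t : ℝ), 0 ≤ t → ∀ (x : Fin d → ℝ) (j : Fin d),
      deriv (fun s => u s x j) t + adv ub (fun y => u t y j) x
          + (ab ^ 2 / (ρb * ε ^ 2)) * pd j (ρ t) x
        = Δt ^ 2 *
            (β₁ * (ab ^ 2 / ε ^ 2) * adv ub (adv ub (pd j (ρ t))) x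
              + β₄ * (ab ^ 4 / (ρb * ε ^ 4)) * lap (pd j (ρ t)) x
              + β₂ * adv ub (adv ub (adv ub (fun y => u t y j))) x
              + β₃ * (ab ^ 2 / ε ^ 2) * adv ub (pd j (dvg (u t))) x)
          + Δt ^ 3 *
            (κ₂ * (ab ^ 2 / (ρb * ε ^ 2)) * adv ub (adv ub (adv ub (pd j (ρ t)))) x
              + κ₃ * (ab ^ 4 / (ρb * ε ^ 4)) * adv ub (lap (pd j (ρ t))) x
              + κ₁ * (ab ^ 2 / ε ^ 2) * adv ub (adv ub (pd j (dvg (u t)))) x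
              + κ₄ * (ab ^ 4 / ε ^ 4) * pd j (lap (dvg (u t))) x
              - (1 / 24) * adv ub (adv ub (adv ub (adv ub (fun y => u t y j)))) x))
    (hρ0 : ∀ x y : Fin d → ℝ, ρ 0 x = ρ 0 y)
    (hu0 : ∀ x : Fin d → ℝ, dvg (u 0) x = 0) :
    ∀ t : ℝ, 0 ≤ t →
      (∀ x y : Fin d → ℝ, ρ t x = ρ t y) ∧ (∀ x : Fin d → ℝ, dvg (u t) x = 0) := by
  have hSρ : ∀ t, SP (ρ t) := fun t =>
    ⟨hρC.comp (contDiff_const.prodMk contDiff_id), hρper t⟩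
  have huC' : ∀ j, ContDiff ℝ (⊤ : ℕ∞) (fun p : ℝ × (Fin d → ℝ) => u p.1 p.2 j) := fun j =>
    (contDiff_apply ℝ ℝ j).comp huC
  have hSu : ∀ t j, SP (fun y => u t y j) := fun t j =>
    ⟨(huC' j).comp (contDiff_const.prodMk contDiff_id), fun x k => congrFun (huper t x k) j⟩
  have hDiv : ∀ (k : Fin d → ℤ) t,
      HC k (dvg (u t)) (∑ j, sy k j * ck k (fun y => u t y j)) := fun k t =>
    HC.hdvg fun j => ⟨hSu t j, rfl⟩
  have main : ∀ (k : Fin d → ℤ), k ≠ 0 → ∀ t, 0 ≤ t →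
      ck k (ρ t) = 0 ∧ ∑ j, sy k j * ck k (fun y => u t y j) = 0 := by
    intro k hk
    obtain ⟨W, hW⟩ : ∃ W : ℂ, W = ∑ i, (ub i : ℂ) * sy k i := ⟨_, rfl⟩
    obtain ⟨L, hL⟩ : ∃ L : ℂ, L = ∑ i, sy k i * sy k i := ⟨_, rfl⟩
    have hadv : ∀ {f : (Fin d → ℝ) → ℝ} {z : ℂ}, HC k f z → HC k (adv ub f) (W * z) := by
      intro f z h; rw [hW]; exact h.hadv ub
    have hlap : ∀ {f : (Fin d → ℝ) → ℝ} {z : ℂ}, HC k f z → HC k (lap f) (L * z) := by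
      intro f z h; rw [hL]; exact h.hlap
    have hmassC : ∀ t, 0 ≤ t → ∀ D, HC k (dvg (u t)) D →
        ck k (fun x => deriv (fun s => ρ s x) t) =
        (-W + Δt ^ 2 * (β₂ * W ^ 3 + β₃ * (ab ^ 2 / ε ^ 2) * W * L)
          + Δt ^ 3 * (κ₁ * (ab ^ 2 / ε ^ 2) * W ^ 2 * L + κ₄ * (ab ^ 4 / ε ^ 4) * L ^ 2
            - (1 / 24) * W ^ 4)) * ck k (ρ t)
        + (-ρb + Δt ^ 2 * (β₁ * ρb * W ^ 2 + β₄ * (ab ^ 2 * ρb / ε ^ 2) * L)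
          + Δt ^ 3 * (κ₂ * ρb * W ^ 3 + κ₃ * (ab ^ 2 * ρb / ε ^ 2) * W * L)) * D := by
      intro t ht D hD
      have hr : HC k (ρ t) (ck k (ρ t)) := ⟨hSρ t, rfl⟩
      have T1 := (((HC.mul β₂ (hadv (hadv (hadv hr)))).add
        (HC.mul (β₃ * (ab ^ 2 / ε ^ 2)) (hadv (hlap hr)))).add
        (HC.mul (β₁ * ρb) (hadv (hadv hD)))).add
        (HC.mul (β₄ * (ab ^ 2 * ρb / ε ^ 2)) (hlap hD))
      have T2 := ((((HC.mul (κ₁ * (ab ^ 2 / ε ^ 2)) (hadv (hadv (hlap hr)))).add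
        (HC.mul (κ₄ * (ab ^ 4 / ε ^ 4)) (hlap (hlap hr)))).sub
        (HC.mul (1 / 24) (hadv (hadv (hadv (hadv hr)))))).add
        (HC.mul (κ₂ * ρb) (hadv (hadv (hadv hD))))).add
        (HC.mul (κ₃ * (ab ^ 2 * ρb / ε ^ 2)) (hadv (hlap hD)))
      have T := (((HC.mul (Δt ^ 2) T1).add (HC.mul (Δt ^ 3) T2)).sub (hadv hr)).sub
        (HC.mul ρb hD)
      have e : (fun x => deriv (fun s => ρ s x) t) = _ :=
        funext fun x => eq_sub_of_add_eq (eq_sub_of_add_eq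
          ((add_right_comm _ _ _).trans (hmass t ht x)))
      rw [e]
      refine T.2.trans ?_
      push_cast
      ring
    have hmomC : ∀ t, 0 ≤ t → ∀ D, HC k (dvg (u t)) D → ∀ j,
        ck k (fun x => deriv (fun s => u s x j) t) =
        sy k j * ((-(ab ^ 2 / (ρb * ε ^ 2))
            + Δt ^ 2 * (β₁ * (ab ^ 2 / ε ^ 2) * W ^ 2 + β₄ * (ab ^ 4 / (ρb * ε ^ 4)) * L)
            + Δt ^ 3 * (κ₂ * (ab ^ 2 / (ρb * ε ^ 2)) * W ^ 3
              + κ₃ * (ab ^ 4 / (ρb * ε ^ 4)) * W * L)) * ck k (ρ t)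
          + (Δt ^ 2 * (β₃ * (ab ^ 2 / ε ^ 2) * W)
            + Δt ^ 3 * (κ₁ * (ab ^ 2 / ε ^ 2) * W ^ 2 + κ₄ * (ab ^ 4 / ε ^ 4) * L)) * D)
        + (-W + Δt ^ 2 * β₂ * W ^ 3 - Δt ^ 3 * (1 / 24) * W ^ 4)
          * ck k (fun y => u t y j) := by
      intro t ht D hD j
      have hr : HC k (ρ t) (ck k (ρ t)) := ⟨hSρ t, rfl⟩
      have hu : HC k (fun y => u t y j) (ck k (fun y => u t y j)) := ⟨hSu t j, rfl⟩
      have T1 := (((HC.mul (β₁ * (ab ^ 2 / ε ^ 2)) (hadv (hadv (hr.hpd j)))).add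
        (HC.mul (β₄ * (ab ^ 4 / (ρb * ε ^ 4))) (hlap (hr.hpd j)))).add
        (HC.mul β₂ (hadv (hadv (hadv hu))))).add
        (HC.mul (β₃ * (ab ^ 2 / ε ^ 2)) (hadv (hD.hpd j)))
      have T2 := ((((HC.mul (κ₂ * (ab ^ 2 / (ρb * ε ^ 2))) (hadv (hadv (hadv (hr.hpd j))))).add
        (HC.mul (κ₃ * (ab ^ 4 / (ρb * ε ^ 4))) (hadv (hlap (hr.hpd j))))).add
        (HC.mul (κ₁ * (ab ^ 2 / ε ^ 2)) (hadv (hadv (hD.hpd j))))).add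
        (HC.mul (κ₄ * (ab ^ 4 / ε ^ 4)) ((hlap hD).hpd j))).sub
        (HC.mul (1 / 24) (hadv (hadv (hadv (hadv hu)))))
      have T := (((HC.mul (Δt ^ 2) T1).add (HC.mul (Δt ^ 3) T2)).sub (hadv hu)).sub
        (HC.mul (ab ^ 2 / (ρb * ε ^ 2)) (hr.hpd j))
      have e : (fun x => deriv (fun s => u s x j) t) = _ :=
        funext fun x => eq_sub_of_add_eq (eq_sub_of_add_eq
          ((add_right_comm _ _ _).trans (hmom t ht x j)))
      rw [e]
      refine T.2.trans ?_
      push_cast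
      ring
    obtain ⟨j0, hj0⟩ : ∃ j, k j ≠ 0 := by
      by_contra! h
      exact hk (funext h)
    intro t ht
    refine ode_zero _ _
      (L * (-(ab ^ 2 / (ρb * ε ^ 2))
            + Δt ^ 2 * (β₁ * (ab ^ 2 / ε ^ 2) * W ^ 2 + β₄ * (ab ^ 4 / (ρb * ε ^ 4)) * L)
            + Δt ^ 3 * (κ₂ * (ab ^ 2 / (ρb * ε ^ 2)) * W ^ 3
              + κ₃ * (ab ^ 4 / (ρb * ε ^ 4)) * W * L)))
      (L * (Δt ^ 2 * (β₃ * (ab ^ 2 / ε ^ 2) * W)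
            + Δt ^ 3 * (κ₁ * (ab ^ 2 / ε ^ 2) * W ^ 2 + κ₄ * (ab ^ 4 / ε ^ 4) * L))
        + (-W + Δt ^ 2 * β₂ * W ^ 3 - Δt ^ 3 * (1 / 24) * W ^ 4))
      (fun t => ck k (ρ t)) (fun t => ∑ j, sy k j * ck k (fun y => u t y j))
      (fun s hs => by
        have h := ck_hasDerivAt k ρ hρC s
        rw [hmassC s hs _ (hDiv k s)] at h
        exact h) ?_ ?_ ?_ t ht
    · intro s hs
      have h := HasDerivAt.fun_sum (u := Finset.univ) fun j _ =>
        (ck_hasDerivAt k (fun s y => u s y j) (huC' j) s).const_mul (sy k j)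
      refine h.congr_deriv ?_
      simp only [hmomC s hs _ (hDiv k s)]
      generalize hX : (∑ j, sy k j * ck k (fun y => u s y j)) = D
      simp only [mul_add (sy k _), Finset.sum_add_distrib, ← mul_assoc (sy k _) (sy k _)]
      simp only [mul_left_comm (sy k _) (_ - _) _, ← Finset.sum_mul, ← Finset.mul_sum, hX, ← hL]
      ring
    · have h0 : pd j0 (ρ 0) = fun _ => 0 := by
        have : ρ 0 = fun _ => ρ 0 0 := funext fun x => hρ0 x 0
        funext x
        rw [this]
        simp [pd]
      have h1 := ck_pd k (hSρ 0) j0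
      rw [h0] at h1
      have h2 : sy k j0 ≠ 0 := by
        simp [sy, hj0, Real.pi_ne_zero]
      have h3 : ck k (fun _ : Fin d → ℝ => (0 : ℝ)) = 0 := by simp [ck]
      rw [h3] at h1
      exact (mul_eq_zero.1 h1.symm).resolve_left h2
    · rw [← (hDiv k 0).2, show dvg (u 0) = fun _ => 0 from funext hu0]
      simp [ck]
  intro t ht
  constructor
  · have hz : ∀ j x, pd j (ρ t) x = 0 := by
      intro j
      refine ((hSρ t).hpd j).eq_zero fun k => ?_
      rw [ck_pd k (hSρ t)]
      by_cases hk : k = 0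
      · simp [sy, hk]
      · rw [(main k hk t ht).1, mul_zero]
    intro x y
    refine is_const_of_fderiv_eq_zero (𝕜 := ℝ) ((hSρ t).1.differentiable (by simp)) (fun x => ?_) x y
    apply ContinuousLinearMap.coe_injective
    refine (Pi.basisFun ℝ (Fin d)).ext fun j => ?_
    simpa [pd] using hz j x
  · refine (hDiv 0 t).1.eq_zero fun k => ?_
    rw [(hDiv k t).2]
    by_cases hk : k = 0
    · simp [sy, hk]
    · exact (main k hk t ht).2
end
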